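/- Let (B_t)_{t ≥ 0} be a standard linear Brownian motion started from 0, and for t ≥ 0 set m_t = min_{0 ≤ r ≤ t} B_r. Then for every ε > 0 and every nonnegative measurable function g : ℝ → [0,∞], E[ ∫₀^∞ 1{m_t > −ε} · g(m_t − B_t) dt ] = 2ε · ∫_{−∞}^0 g(x) dx. -/

import Mathlib

open MeasureTheory ProbabilityTheory
open scoped ENNReal

/-- A standard Brownian motion all of whose paths are continuous and start from `0`. -/
structure IsContinuousBrownian {Ω : Type*} [MeasurableSpace Ω] (B : ℝ → Ω → ℝ)
    (P : Measure Ω) : Prop where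
  measurable : ∀ t, Measurable (B t)
  continuous : ∀ ω, Continuous fun t => B t ω
  zero : ∀ ω, B 0 ω = 0
  gauss : ∀ s t : ℝ, 0 ≤ s → s ≤ t →
    P.map (fun ω => B t ω - B s ω) = gaussianReal 0 (Real.toNNReal (t - s))
  indep : ∀ s t : ℝ, 0 ≤ s → s ≤ t → ∀ (n : ℕ) (r : Fin n → ℝ),
    (∀ i, 0 ≤ r i ∧ r i ≤ s) →
    IndepFun (fun ω => B t ω - B s ω) (fun ω i => B (r i) ω) P

/-- The minimum of a process over `[0, t]`, parametrised by the unit interval. -/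
noncomputable def runMin {Ω : Type*} (B : ℝ → Ω → ℝ) (t : ℝ) (ω : Ω) : ℝ :=
  sInf ((fun u => B (t * u) ω) '' Set.Icc 0 1)

section RunMin

variable {Ω : Type*} {B : ℝ → Ω → ℝ} {t c : ℝ} {ω : Ω}

lemma runMin_eq_sInf (ht : 0 ≤ t) :
    runMin B t ω = sInf ((fun r => B r ω) '' Set.Icc 0 t) := by
  have h : (fun u => t * u) '' Set.Icc (0:ℝ) 1 = Set.Icc 0 t := by
    rw [Set.image_mul_left_Icc ht zero_le_one]; simp
  rw [runMin, ← h, Set.image_image]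

lemma runMin_lt_iff (h : Continuous fun t => B t ω) :
    runMin B t ω < c ↔ ∃ u ∈ Set.Icc (0:ℝ) 1, B (t * u) ω < c := by
  have hc : Continuous fun u => B (t * u) ω := h.comp (continuous_const.mul continuous_id)
  rw [runMin, csInf_lt_iff (isCompact_Icc.image hc).bddBelow
    ((Set.nonempty_Icc.2 zero_le_one).image _)]
  simp

lemma runMin_le (h : Continuous fun t => B t ω) : runMin B t ω ≤ B t ω := by
  have hc : Continuous fun u => B (t * u) ω := h.comp (continuous_const.mul continuous_id)
  exact csInf_le (isCompact_Icc.image hc).bddBelow ⟨1, by simp⟩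

lemma runMin_nonpos (h : Continuous fun t => B t ω) (h0 : B 0 ω = 0) : runMin B t ω ≤ 0 := by
  have hc : Continuous fun u => B (t * u) ω := h.comp (continuous_const.mul continuous_id)
  exact csInf_le (isCompact_Icc.image hc).bddBelow ⟨0, by simp [h0]⟩

lemma runMin_lt_iff_rat (h : Continuous fun t => B t ω) :
    runMin B t ω < c ↔ ∃ q : ℚ, (q : ℝ) ∈ Set.Icc (0:ℝ) 1 ∧ B (t * q) ω < c := by
  have hc : Continuous fun u => B (t * u) ω := h.comp (continuous_const.mul continuous_id)
  rw [runMin_lt_iff h]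
  refine ⟨fun ⟨u, hu, hlt⟩ => ?_, fun ⟨q, hq, hlt⟩ => ⟨q, hq, hlt⟩⟩
  have hcl : u ∈ closure (Set.Ioo (0:ℝ) 1) := by rwa [closure_Ioo zero_ne_one]
  obtain ⟨v, hv, hv'⟩ := mem_closure_iff.1 hcl _ (isOpen_lt hc continuous_const) hlt
  obtain ⟨q, hq⟩ := (Rat.denseRange_cast (𝕜 := ℝ)).exists_mem_open
    ((isOpen_lt hc continuous_const).inter isOpen_Ioo) ⟨v, hv, hv'⟩
  exact ⟨q, Set.Ioo_subset_Icc_self hq.2, hq.1⟩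

/-- Along regular subdivisions, the first value below a level `c ≤ B 0` converges to `c`. -/
lemma exists_first_passage (h : Continuous fun t => B t ω) (h0 : B 0 ω = 0) (hc : c ≤ 0)
    (hlt : runMin B t ω < c) {δ : ℝ} (hδ : 0 < δ) :
    ∀ᶠ N : ℕ in Filter.atTop, ∃ k ∈ Finset.range (N + 2),
      B (t * (k / (N + 1))) ω < c ∧ (∀ j < k, c ≤ B (t * (j / (N + 1))) ω) ∧
      |B (t * (k / (N + 1))) ω - c| < δ := by
  have hf : Continuous fun u => B (t * u) ω := h.comp (continuous_const.mul continuous_id)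
  obtain ⟨u, hu, hult⟩ := (runMin_lt_iff h).1 hlt
  obtain ⟨η, hη, hunif⟩ := Metric.uniformContinuousOn_iff.1
    ((isCompact_Icc (a := (0:ℝ)) (b := 1)).uniformContinuousOn_of_continuous hf.continuousOn)
    (min δ (c - B (t * u) ω)) (lt_min hδ (sub_pos.2 hult))
  have hlim : Filter.Tendsto (fun N : ℕ => 1 / ((N : ℝ) + 1)) Filter.atTop (nhds 0) :=
    tendsto_one_div_add_atTop_nhds_zero_nat
  filter_upwards [hlim.eventually (gt_mem_nhds hη)] with N hN
  have hN0 : (0:ℝ) < N + 1 := by positivity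
  have hmem : ∀ k ≤ N + 1, (k / (N + 1) : ℝ) ∈ Set.Icc (0:ℝ) 1 := fun k hk =>
    ⟨by positivity, by rw [div_le_one hN0]; exact_mod_cast hk⟩
  have hex' : ∃ k ≤ N + 1, B (t * (k / (N + 1))) ω < c := by
    refine ⟨⌊u * (N + 1)⌋₊, ?_⟩
    have h1 : (⌊u * (N + 1)⌋₊ : ℝ) ≤ u * (N + 1) := Nat.floor_le (mul_nonneg hu.1 hN0.le)
    have h2 : u * (N + 1) < ⌊u * (N + 1)⌋₊ + 1 := Nat.lt_floor_add_one _
    have hk : ⌊u * (N + 1)⌋₊ ≤ N + 1 := by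
      have : u * (N + 1) ≤ ((N + 1 : ℕ) : ℝ) := by push_cast; nlinarith [hu.2]
      exact Nat.floor_le_of_le this
    have hd : dist ((⌊u * (N + 1)⌋₊ : ℝ) / (N + 1)) u < η := by
      rw [Real.dist_eq, abs_lt]
      have e : (⌊u * (N + 1)⌋₊ : ℝ) / (N + 1) - u = (⌊u * (N + 1)⌋₊ - u * (N + 1)) / (N + 1) := by
        field_simp
      have e1 : -(1 / ((N:ℝ) + 1)) ≤ (⌊u * (N + 1)⌋₊ - u * (N + 1)) / (N + 1) := by
        rw [← neg_div]; gcongr; linarith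
      have e2 : (⌊u * (N + 1)⌋₊ - u * (N + 1)) / ((N:ℝ) + 1) ≤ 0 :=
        div_nonpos_of_nonpos_of_nonneg (by linarith) hN0.le
      constructor <;> linarith
    refine ⟨hk, ?_⟩
    have := hunif _ (hmem _ hk) u hu hd
    rw [Real.dist_eq] at this
    have := (le_abs_self _).trans_lt (this.trans_le (min_le_right _ _))
    linarith
  obtain ⟨k', hk', hlt'⟩ := hex'
  have hex : ∃ k : ℕ, B (t * (k / (N + 1))) ω < c := ⟨k', hlt'⟩
  classical
  have hfind : ∀ j < Nat.find hex, c ≤ B (t * (j / (N + 1))) ω :=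
    fun j hj => not_lt.1 (Nat.find_min hex hj)
  have hle : Nat.find hex ≤ N + 1 := (Nat.find_min' hex hlt').trans hk'
  have hspec := Nat.find_spec hex
  generalize Nat.find hex = k at hfind hle hspec
  refine ⟨k, by simp; omega, hspec, hfind, ?_⟩
  obtain _ | j := k
  · simp [h0] at hspec; linarith
  have hj := hfind j (Nat.lt_succ_self j)
  have hd : dist (((j + 1 : ℕ) : ℝ) / (N + 1)) (j / (N + 1)) < η := by
    rw [Real.dist_eq, ← sub_div]
    push_cast
    rw [add_sub_cancel_left, abs_of_pos (by positivity)]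
    exact hN
  have := hunif _ (hmem _ hle) _ (hmem j (by omega)) hd
  rw [Real.dist_eq, abs_lt] at this
  have h3 := min_le_left δ (c - B (t * u) ω)
  rw [abs_lt]
  constructor <;> linarith [this.1]

/-- The event that `k / (N + 1)` is the first point of the subdivision of `[0, 1]` at which the
time-scaled process is below `c`. -/
def firstPassage (B : ℝ → Ω → ℝ) (t c : ℝ) (N k : ℕ) : Set Ω :=
  {ω | B (t * (k / (N + 1))) ω < c ∧ ∀ j < k, c ≤ B (t * (j / (N + 1))) ω}

lemma sum_firstPassage_of_mem {N k : ℕ} (hk : k ∈ Finset.range (N + 2))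
    (h : ω ∈ firstPassage B t c N k) (f : ℕ → Ω → ℝ≥0∞) :
    ∑ i ∈ Finset.range (N + 2), (firstPassage B t c N i).indicator (f i) ω = f k ω := by
  rw [Finset.sum_eq_single_of_mem k hk, Set.indicator_of_mem h]
  intro i _ hik
  refine Set.indicator_of_notMem (fun hi => ?_) _
  rcases lt_or_gt_of_ne hik with hlt | hlt
  · exact absurd hi.1 (not_lt.2 (h.2 i hlt))
  · exact absurd h.1 (not_lt.2 (hi.2 k hlt))

lemma sum_firstPassage_le (N : ℕ) {f : ℕ → Ω → ℝ≥0∞} {C : ℝ≥0∞} (hf : ∀ k, f k ω ≤ C) :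
    ∑ i ∈ Finset.range (N + 2), (firstPassage B t c N i).indicator (f i) ω ≤ C := by
  by_cases h : ∃ k ∈ Finset.range (N + 2), ω ∈ firstPassage B t c N k
  · obtain ⟨k, hk, hω⟩ := h
    rw [sum_firstPassage_of_mem hk hω]
    exact hf k
  · push Not at h
    rw [Finset.sum_eq_zero fun k hk => Set.indicator_of_notMem (h k hk) _]
    exact zero_le

lemma tendsto_sum_firstPassage (h : Continuous fun t => B t ω) (h0 : B 0 ω = 0) (hc : c ≤ 0)
    {ψ : ℝ → Ω → ℝ≥0∞} (hψ : Continuous fun y => ψ y ω) :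
    Filter.Tendsto (fun N : ℕ => ∑ k ∈ Finset.range (N + 2), (firstPassage B t c N k).indicator
        (fun ω => ψ (B (t * (k / (N + 1))) ω) ω) ω) Filter.atTop
      (nhds ({ω | runMin B t ω < c}.indicator (ψ c) ω)) := by
  by_cases hlt : runMin B t ω < c
  · rw [Set.indicator_of_mem (show ω ∈ {ω | runMin B t ω < c} from hlt)]
    refine Filter.tendsto_def.2 fun U hU => ?_
    obtain ⟨δ, hδ, hball⟩ := Metric.mem_nhds_iff.1 (hψ.continuousAt (x := c) hU)
    filter_upwards [exists_first_passage h h0 hc hlt hδ] with N ⟨k, hk, h1, h2, h3⟩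
    rw [Set.mem_preimage, sum_firstPassage_of_mem hk ⟨h1, h2⟩]
    exact hball (by rwa [Metric.mem_ball, Real.dist_eq])
  · rw [Set.indicator_of_notMem (show ω ∉ {ω | runMin B t ω < c} from hlt)]
    refine tendsto_const_nhds.congr fun N => (Finset.sum_eq_zero fun k hk => ?_).symm
    refine Set.indicator_of_notMem (fun hω => hlt ((runMin_lt_iff h).2 ⟨_, ⟨?_, ?_⟩, hω.1⟩)) _
    · positivity
    · rw [div_le_one (by positivity)]
      exact_mod_cast Nat.lt_succ_iff.1 (Finset.mem_range.1 hk)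

end RunMin

section Reflection

variable {Ω : Type*} [MeasurableSpace Ω] {P : Measure Ω} {B : ℝ → Ω → ℝ}

lemma IsContinuousBrownian.lintegral_neg_increment [IsProbabilityMeasure P]
    (hB : IsContinuousBrownian B P) {s t : ℝ}
    (hs : 0 ≤ s) (hst : s ≤ t) {n : ℕ} {r : Fin n → ℝ} (hr : ∀ i, 0 ≤ r i ∧ r i ≤ s)
    {F : (Fin n → ℝ) × ℝ → ℝ≥0∞} (hF : Measurable F) :
    ∫⁻ ω, F (fun i => B (r i) ω, B t ω - B s ω) ∂P
      = ∫⁻ ω, F (fun i => B (r i) ω, -(B t ω - B s ω)) ∂P := by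
  have hV : Measurable fun ω i => B (r i) ω := measurable_pi_lambda _ fun i => hB.measurable _
  have hD : Measurable fun ω => B t ω - B s ω := (hB.measurable t).sub (hB.measurable s)
  have hind := (hB.indep s t hs hst n r hr).symm
  have hind' : IndepFun (fun ω i => B (r i) ω) (fun ω => -(B t ω - B s ω)) P :=
    hind.comp measurable_id measurable_neg
  have e1 := (indepFun_iff_map_prod_eq_prod_map_map hV.aemeasurable hD.aemeasurable).1 hind
  have e2 := (indepFun_iff_map_prod_eq_prod_map_map hV.aemeasurable hD.neg.aemeasurable).1 hind'
  have e3 : P.map (fun ω => -(B t ω - B s ω)) = P.map (fun ω => B t ω - B s ω) := by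
    have := Measure.map_map (μ := P) measurable_neg hD
    rw [hB.gauss s t hs hst]
    rw [hB.gauss s t hs hst, gaussianReal_map_neg, neg_zero] at this
    exact this.symm
  have e4 := (e1.trans (congrArg _ e3.symm)).trans e2.symm
  have l1 := lintegral_map (μ := P) hF (hV.prodMk hD)
  have l2 := lintegral_map (μ := P) hF (hV.prodMk hD.neg)
  rw [← l1, e4, l2]
  rfl

lemma IsContinuousBrownian.measurableSet_firstPassage (hB : IsContinuousBrownian B P)
    (t c : ℝ) (N k : ℕ) : MeasurableSet (firstPassage B t c N k) := by
  refine (measurableSet_lt (hB.measurable _) measurable_const).inter ?_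
  have : {ω | ∀ j < k, c ≤ B (t * (j / (N + 1))) ω}
      = ⋂ j : ℕ, ⋂ _ : j < k, {ω | c ≤ B (t * (j / (N + 1))) ω} := by ext; simp
  change MeasurableSet {ω | ∀ j < k, c ≤ B (t * (j / (N + 1))) ω}
  rw [this]
  exact MeasurableSet.iInter fun j => MeasurableSet.iInter fun _ =>
    measurableSet_le measurable_const (hB.measurable _)

lemma IsContinuousBrownian.lintegral_firstPassage_reflect [IsProbabilityMeasure P]
    (hB : IsContinuousBrownian B P)
    {t : ℝ} (ht : 0 ≤ t) (c : ℝ) {N k : ℕ} (hk : k ≤ N + 1) {φ : ℝ → ℝ≥0∞} (hφ : Measurable φ) :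
    ∫⁻ ω, (firstPassage B t c N k).indicator (fun ω => φ (B t ω)) ω ∂P
      = ∫⁻ ω, (firstPassage B t c N k).indicator
          (fun ω => φ (2 * B (t * (k / (N + 1))) ω - B t ω)) ω ∂P := by
  have hN0 : (0:ℝ) < N + 1 := by positivity
  set r : Fin (k + 1) → ℝ := fun i => t * (i / (N + 1)) with hr
  have hs : 0 ≤ t * ((k:ℝ) / (N + 1)) := by positivity
  have hst : t * ((k:ℝ) / (N + 1)) ≤ t :=
    mul_le_of_le_one_right ht (by rw [div_le_one hN0]; exact_mod_cast hk)
  set S : Set ((Fin (k + 1) → ℝ) × ℝ) :=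
    {p | p.1 (Fin.last k) < c} ∩ ⋂ j : Fin k, {p | c ≤ p.1 j.castSucc} with hS
  have hSm : MeasurableSet S :=
    (measurableSet_lt (by fun_prop) measurable_const).inter
      (MeasurableSet.iInter fun j => measurableSet_le measurable_const (by fun_prop))
  have hF : Measurable (S.indicator fun p => φ (p.1 (Fin.last k) + p.2)) :=
    (hφ.comp (by fun_prop)).indicator hSm
  have key := hB.lintegral_neg_increment hs hst (r := r) (fun i => ⟨by positivity, by
    have : ((i : ℕ) : ℝ) ≤ k := by exact_mod_cast Nat.lt_succ_iff.1 i.2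
    simp only [hr]; gcongr⟩) hF
  have hmem : ∀ ω d, ((fun i => B (r i) ω, d) : (Fin (k + 1) → ℝ) × ℝ) ∈ S
      ↔ ω ∈ firstPassage B t c N k := by
    intro ω d
    simp only [hS, hr, firstPassage, Set.mem_inter_iff, Set.mem_ofPred_eq, Set.mem_iInter,
      Fin.val_last, Fin.val_castSucc]
    exact and_congr_right fun _ => ⟨fun h j hj => h ⟨j, hj⟩, fun h j => h j j.2⟩
  convert key using 2
  · ext ω
    by_cases h : ω ∈ firstPassage B t c N k
    · rw [Set.indicator_of_mem h, Set.indicator_of_mem ((hmem ω _).2 h)]; simp [hr]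
    · rw [Set.indicator_of_notMem h, Set.indicator_of_notMem (mt (hmem ω _).1 h)]
  · ext ω
    by_cases h : ω ∈ firstPassage B t c N k
    · rw [Set.indicator_of_mem h, Set.indicator_of_mem ((hmem ω _).2 h)]
      simp only [hr, Fin.val_last]; congr 1; ring
    · rw [Set.indicator_of_notMem h, Set.indicator_of_notMem (mt (hmem ω _).1 h)]

lemma IsContinuousBrownian.measurable_uncurry (hB : IsContinuousBrownian B P) :
    Measurable fun p : ℝ × Ω => B p.1 p.2 :=
  measurable_uncurry_of_continuous_of_measurable hB.continuous hB.measurable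

lemma IsContinuousBrownian.measurable_runMin_uncurry (hB : IsContinuousBrownian B P) :
    Measurable fun p : ℝ × Ω => runMin B p.1 p.2 := by
  refine measurable_of_Iio fun c => ?_
  have : (fun p : ℝ × Ω => runMin B p.1 p.2) ⁻¹' Set.Iio c
      = ⋃ q : ℚ, ⋃ _ : (q : ℝ) ∈ Set.Icc (0:ℝ) 1, {p | B (p.1 * q) p.2 < c} := by
    ext p
    simp only [Set.mem_preimage, Set.mem_Iio, runMin_lt_iff_rat (hB.continuous p.2),
      Set.mem_iUnion, exists_prop, Set.mem_ofPred_eq]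
  rw [this]
  refine MeasurableSet.iUnion fun q => MeasurableSet.iUnion fun _ => ?_
  have hm : Measurable fun p : ℝ × Ω => B (p.1 * q) p.2 :=
    hB.measurable_uncurry.comp ((measurable_fst.mul_const _).prodMk measurable_snd)
  exact measurableSet_lt hm measurable_const

lemma IsContinuousBrownian.measurable_runMin (hB : IsContinuousBrownian B P) (t : ℝ) :
    Measurable (runMin B t) :=
  hB.measurable_runMin_uncurry.comp measurable_prodMk_left

lemma IsContinuousBrownian.tendsto_lintegral_firstPassage [IsProbabilityMeasure P]
    (hB : IsContinuousBrownian B P)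
    (t : ℝ) {c : ℝ} (hc : c ≤ 0) (φ : BoundedContinuousFunction ℝ NNReal) {f : ℝ → ℝ → ℝ}
    (hf : Continuous (Function.uncurry f)) :
    Filter.Tendsto (fun N : ℕ => ∫⁻ ω, ∑ k ∈ Finset.range (N + 2),
        (firstPassage B t c N k).indicator
        (fun ω => (φ (f (B (t * (k / (N + 1))) ω) (B t ω)) : ℝ≥0∞)) ω ∂P) Filter.atTop
      (nhds (∫⁻ ω, {ω | runMin B t ω < c}.indicator (fun ω => (φ (f c (B t ω)) : ℝ≥0∞)) ω ∂P)) := by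
  have hφ : Continuous fun x => (φ x : ℝ≥0∞) := ENNReal.continuous_coe.comp φ.continuous
  refine tendsto_lintegral_of_dominated_convergence (fun _ => (nndist φ 0 : ℝ≥0∞)) ?_ ?_ ?_ ?_
  · refine fun N => Finset.measurable_sum _ fun k _ =>
      Measurable.indicator ?_ (hB.measurableSet_firstPassage t c N k)
    exact hφ.measurable.comp (hf.measurable.comp ((hB.measurable _).prodMk (hB.measurable t)))
  · exact fun N => ae_of_all _ fun ω => sum_firstPassage_le N fun k =>
      ENNReal.coe_le_coe.2 (BoundedContinuousFunction.NNReal.upper_bound φ _)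
  · simp
  · exact ae_of_all _ fun ω => tendsto_sum_firstPassage (ψ := fun y ω => (φ (f y (B t ω)) : ℝ≥0∞))
      (hB.continuous ω) (hB.zero ω) hc
      (hφ.comp (hf.comp (continuous_id.prodMk continuous_const)))

/-- The reflection principle. -/
lemma IsContinuousBrownian.map_restrict_reflect [IsProbabilityMeasure P]
    (hB : IsContinuousBrownian B P)
    {t c : ℝ} (ht : 0 ≤ t) (hc : c ≤ 0) :
    (P.restrict {ω | runMin B t ω < c}).map (B t)
      = (P.restrict {ω | runMin B t ω < c}).map (fun ω => 2 * c - B t ω) := by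
  have hm : MeasurableSet {ω | runMin B t ω < c} :=
    measurableSet_lt (hB.measurable_runMin t) measurable_const
  refine ext_of_forall_lintegral_eq_of_IsFiniteMeasure fun φ => ?_
  have hφ : Measurable fun x => (φ x : ℝ≥0∞) :=
    (ENNReal.continuous_coe.comp φ.continuous).measurable
  rw [lintegral_map hφ (hB.measurable t), lintegral_map hφ ((hB.measurable t).const_sub _),
    ← lintegral_indicator hm, ← lintegral_indicator hm]
  refine tendsto_nhds_unique
    (hB.tendsto_lintegral_firstPassage t hc φ (f := fun _ x => x) continuous_snd) ?_
  refine (hB.tendsto_lintegral_firstPassage t hc φ (f := fun y x => 2 * y - x)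
    (by unfold Function.uncurry; fun_prop)).congr fun N => ?_
  have hmeas : ∀ k, ∀ g : Ω → ℝ, Measurable g →
      Measurable ((firstPassage B t c N k).indicator fun ω => (φ (g ω) : ℝ≥0∞)) :=
    fun k g hg => (hφ.comp hg).indicator (hB.measurableSet_firstPassage t c N k)
  rw [lintegral_finsetSum _ fun k _ => hmeas k _
      (show Measurable fun ω => 2 * B (t * (k / (N + 1))) ω - B t ω from
        ((hB.measurable _).const_mul 2).sub (hB.measurable t)),
    lintegral_finsetSum _ fun k _ => hmeas k _ (hB.measurable t)]
  exact Finset.sum_congr rfl fun k hk => (hB.lintegral_firstPassage_reflect ht c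
    (Nat.lt_succ_iff.1 (Finset.mem_range.1 hk)) hφ).symm

lemma IsContinuousBrownian.map_eq (hB : IsContinuousBrownian B P) {t : ℝ} (ht : 0 ≤ t) :
    P.map (B t) = gaussianReal 0 t.toNNReal := by
  simpa [hB.zero] using hB.gauss 0 t le_rfl ht

lemma gaussianPDF_reflect_le {c x : ℝ} (hc : c ≤ 0) (hx : c < x) (v : NNReal) :
    gaussianPDF (2 * c) v x ≤ gaussianPDF 0 v x := by
  refine ENNReal.ofReal_le_ofReal ?_
  unfold gaussianPDFReal
  gcongr ?_ * Real.exp (?_ / ?_)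
  nlinarith

lemma IsContinuousBrownian.measure_le_runMin [IsProbabilityMeasure P]
    (hB : IsContinuousBrownian B P)
    {t c : ℝ} (ht : 0 < t) (hc : c ≤ 0) {A : Set ℝ} (hA : MeasurableSet A) :
    P {ω | c ≤ runMin B t ω ∧ B t ω ∈ A}
      = ∫⁻ x in A ∩ Set.Ioi c,
          (gaussianPDF 0 t.toNNReal x - gaussianPDF (2 * c) t.toNNReal x) := by
  have hv : t.toNNReal ≠ 0 := by simpa using ht
  have hA' : MeasurableSet (A ∩ Set.Ioi c) := hA.inter measurableSet_Ioi
  have hm : MeasurableSet {ω | runMin B t ω < c} :=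
    measurableSet_lt (hB.measurable_runMin t) measurable_const
  have hlaw : ∀ s, MeasurableSet s → P (B t ⁻¹' s) = ∫⁻ x in s, gaussianPDF 0 t.toNNReal x :=
    fun s hs => by
      rw [← Measure.map_apply (hB.measurable t) hs, hB.map_eq ht.le, gaussianReal_apply _ hv]
  have hlaw' : P ((fun ω => 2 * c - B t ω) ⁻¹' (A ∩ Set.Ioi c))
      = ∫⁻ x in A ∩ Set.Ioi c, gaussianPDF (2 * c) t.toNNReal x := by
    rw [← Measure.map_apply ((hB.measurable t).const_sub _) hA', ← gaussianReal_apply _ hv]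
    have := Measure.map_map (μ := P) (g := fun x => 2 * c - x) (by fun_prop) (hB.measurable t)
    rw [hB.map_eq ht.le, gaussianReal_map_const_sub, sub_zero] at this
    rw [this]
    rfl
  have hnull : P (B t ⁻¹' {c}) = 0 := by
    rw [hlaw _ (measurableSet_singleton c), setLIntegral_measure_zero _ _ Real.volume_singleton]
  have h1 : P {ω | c ≤ runMin B t ω ∧ B t ω ∈ A}
      = P (B t ⁻¹' (A ∩ Set.Ioi c) \ {ω | runMin B t ω < c}) := by
    refine le_antisymm ?_ (measure_mono ?_)
    · have h : {ω | c ≤ runMin B t ω ∧ B t ω ∈ A}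
          ⊆ (B t ⁻¹' (A ∩ Set.Ioi c) \ {ω | runMin B t ω < c}) ∪ B t ⁻¹' {c} := ?_
      · exact (measure_mono h).trans ((measure_union_le _ _).trans_eq (by rw [hnull, add_zero]))
      rintro ω ⟨h1, h2⟩
      rcases (h1.trans (runMin_le (hB.continuous ω))).eq_or_lt with h3 | h3
      · exact Or.inr h3.symm
      · exact Or.inl ⟨⟨h2, h3⟩, not_lt.2 h1⟩
    · rintro ω ⟨⟨h1, -⟩, h2⟩
      exact ⟨not_lt.1 h2, h1⟩
  have h2 : P (B t ⁻¹' (A ∩ Set.Ioi c) ∩ {ω | runMin B t ω < c})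
      = P ((fun ω => 2 * c - B t ω) ⁻¹' (A ∩ Set.Ioi c)) := by
    have := congrArg (fun μ => μ (A ∩ Set.Ioi c)) (hB.map_restrict_reflect ht.le hc)
    beta_reduce at this
    rw [Measure.map_apply (hB.measurable t) hA',
      Measure.map_apply ((hB.measurable t).const_sub _) hA',
      Measure.restrict_apply (hB.measurable t hA'),
      Measure.restrict_apply ((hB.measurable t).const_sub _ hA')] at this
    rw [this, Set.inter_eq_left.2]
    rintro ω ⟨-, h⟩
    have h : c < 2 * c - B t ω := h
    exact (runMin_le (hB.continuous ω)).trans_lt (by linarith)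
  rw [h1, ← Set.sdiff_self_inter, measure_sdiff Set.inter_subset_left
    ((hB.measurable t hA').inter hm).nullMeasurableSet (measure_ne_top _ _), h2, hlaw', hlaw _ hA']
  refine (lintegral_sub' (measurable_gaussianPDF _ _).aemeasurable
    (hlaw' ▸ measure_ne_top _ _) ?_).symm
  exact (ae_restrict_iff' hA').2 (ae_of_all _ fun x hx => gaussianPDF_reflect_le hc hx.2 _)

end Reflection

lemma lintegral_Ioi_gaussianPDF_div {u : ℝ} (hu : 0 < u) :
    ∫⁻ t in Set.Ioi (0:ℝ), ENNReal.ofReal (u / t * gaussianPDFReal 0 t.toNNReal u) = 1 := by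
  have himg : (fun t => u / √t) '' Set.Ioi 0 = Set.Ioi 0 := by
    ext s
    refine ⟨?_, fun hs => ⟨(u / s) ^ 2, ?_, ?_⟩⟩
    · rintro ⟨t, ht, rfl⟩
      exact div_pos hu (Real.sqrt_pos.2 ht)
    · exact pow_pos (div_pos hu hs) 2
    · have hs : 0 < s := hs
      simp only
      rw [Real.sqrt_sq (by positivity)]
      field_simp
  have hinj : Set.InjOn (fun t => u / √t) (Set.Ioi 0) := by
    intro a ha b hb hab
    have ha' := Real.sqrt_pos.2 ha
    have hb' := Real.sqrt_pos.2 hb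
    simp only at hab
    rw [div_eq_div_iff ha'.ne' hb'.ne'] at hab
    exact ((Real.sqrt_inj (le_of_lt hb) (le_of_lt ha)).1 (mul_left_cancel₀ hu.ne' hab)).symm
  have hsub := lintegral_image_eq_lintegral_abs_deriv_mul (s := Set.Ioi 0)
    (f := fun t => u / √t) (f' := fun t => -(u * (1 / (2 * √t))) / √t ^ 2) measurableSet_Ioi
    (fun t ht => by
      have := (HasDerivAt.div (hasDerivAt_const t u) (Real.hasDerivAt_sqrt (ne_of_gt ht))
        (Real.sqrt_pos.2 ht).ne').hasDerivWithinAt (s := Set.Ioi 0)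
      rw [zero_mul, zero_sub] at this
      exact this) hinj
    (fun s => ENNReal.ofReal (2 * (√(2 * Real.pi))⁻¹ * Real.exp (-(1 / 2) * s ^ 2)))
  rw [himg, ← ofReal_integral_eq_lintegral_ofReal, integral_const_mul,
    integral_gaussian_Ioi] at hsub
  · rw [show 2 * (√(2 * Real.pi))⁻¹ * (√(Real.pi / (1 / 2)) / 2) = 1 by
      rw [show Real.pi / (1 / 2) = 2 * Real.pi by ring]
      have : √(2 * Real.pi) ≠ 0 := by positivity
      field_simp, ENNReal.ofReal_one] at hsub
    rw [hsub]
    refine setLIntegral_congr_fun measurableSet_Ioi fun t ht => ?_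
    have ht : 0 < t := ht
    have hs := Real.sqrt_pos.2 ht
    rw [← ENNReal.ofReal_mul (abs_nonneg _), neg_div, abs_neg, abs_of_pos (by positivity),
      gaussianPDFReal, Real.coe_toNNReal _ ht.le, Real.sqrt_mul (by positivity), sub_zero, div_pow,
      Real.sq_sqrt ht.le, show -(1 / 2) * (u ^ 2 / t) = -u ^ 2 / (2 * t) by field_simp]
    congr 1
    field_simp
  · exact ((integrable_exp_neg_mul_sq (by norm_num)).const_mul _).integrableOn
  · exact ae_of_all _ fun s => by positivity

lemma gaussianPDF_sub_eq_lintegral {t a b : ℝ} (ht : 0 < t) (ha : 0 ≤ a) (hab : a ≤ b) :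
    gaussianPDF 0 t.toNNReal a - gaussianPDF 0 t.toNNReal b
      = ∫⁻ u in Set.Ioc a b, ENNReal.ofReal (u / t * gaussianPDFReal 0 t.toNNReal u) := by
  have hd : ∀ u : ℝ, HasDerivAt (fun u => -gaussianPDFReal 0 t.toNNReal u)
      (u / t * gaussianPDFReal 0 t.toNNReal u) u := by
    intro u
    unfold gaussianPDFReal
    simp only [Real.coe_toNNReal _ ht.le, sub_zero]
    have := ((((hasDerivAt_id u).pow 2).neg.div_const (2 * t)).exp.const_mul
      (√(2 * Real.pi * t))⁻¹).neg
    refine this.congr_deriv ?_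
    simp only [id, Pi.neg_apply, Pi.pow_apply]
    field_simp
    simp
  have hcont : Continuous fun u => u / t * gaussianPDFReal 0 t.toNNReal u := by
    unfold gaussianPDFReal
    fun_prop
  have hint : IntervalIntegrable (fun u => u / t * gaussianPDFReal 0 t.toNNReal u) volume a b :=
    hcont.intervalIntegrable a b
  have h := intervalIntegral.integral_eq_sub_of_hasDerivAt (fun u _ => hd u) hint
  rw [intervalIntegral.integral_of_le hab] at h
  rw [← ofReal_integral_eq_lintegral_ofReal hint.1, h, gaussianPDF, gaussianPDF,
    ← ENNReal.ofReal_sub _ (gaussianPDFReal_nonneg _ _ _)]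
  · congr 1; ring
  · exact (ae_restrict_iff' measurableSet_Ioc).2 (ae_of_all _ fun u hu =>
      mul_nonneg (div_nonneg (ha.trans hu.1.le) ht.le) (gaussianPDFReal_nonneg _ _ _))

lemma measurable_gaussianPDFReal_uncurry (m : ℝ) :
    Measurable fun p : ℝ × ℝ => gaussianPDFReal m p.1.toNNReal p.2 := by
  unfold gaussianPDFReal
  fun_prop

/-- The potential kernel of Brownian motion. -/
lemma lintegral_Ioi_gaussianPDF_sub {a b : ℝ} (ha : 0 ≤ a) (hab : a ≤ b) :
    ∫⁻ t in Set.Ioi (0:ℝ), (gaussianPDF 0 t.toNNReal a - gaussianPDF 0 t.toNNReal b)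
      = ENNReal.ofReal (b - a) := by
  rw [setLIntegral_congr_fun measurableSet_Ioi fun t ht => gaussianPDF_sub_eq_lintegral ht ha hab,
    lintegral_lintegral_swap]
  · rw [setLIntegral_congr_fun measurableSet_Ioc fun u hu =>
      lintegral_Ioi_gaussianPDF_div (ha.trans_lt hu.1)]
    simp
  · have := measurable_gaussianPDFReal_uncurry 0
    exact ((measurable_snd.div measurable_fst).mul this).ennreal_ofReal.aemeasurable

lemma lintegral_Ioi_gaussianPDF_reflect {c x : ℝ} (hc : c ≤ 0) (hx : c < x) :
    ∫⁻ t in Set.Ioi (0:ℝ), (gaussianPDF 0 t.toNNReal x - gaussianPDF (2 * c) t.toNNReal x)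
      = 2 * volume (Set.Ioo c (min 0 x)) := by
  have h1 : ∀ v, gaussianPDF 0 v x = gaussianPDF 0 v |x| := fun v => by
    simp [gaussianPDF, gaussianPDFReal]
  have h2 : ∀ v, gaussianPDF (2 * c) v x = gaussianPDF 0 v (x - 2 * c) := fun v => by
    simp [gaussianPDF, gaussianPDFReal]
  simp only [h1, h2]
  have hle : |x| ≤ x - 2 * c := abs_le.2 ⟨by linarith, by linarith⟩
  rw [lintegral_Ioi_gaussianPDF_sub (abs_nonneg x) hle, Real.volume_Ioo,
    show (2:ℝ≥0∞) = ENNReal.ofReal 2 by simp, ← ENNReal.ofReal_mul zero_le_two]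
  congr 1
  rcases le_total 0 x with h | h
  · rw [abs_of_nonneg h, min_eq_left h]; ring
  · rw [abs_of_nonpos h, min_eq_right h]; ring

section Occupation

variable {Ω : Type*} [MeasurableSpace Ω] {P : Measure Ω} {B : ℝ → Ω → ℝ}

lemma measurable_gaussianPDF_uncurry (m : ℝ) :
    Measurable fun p : ℝ × ℝ => gaussianPDF m p.1.toNNReal p.2 :=
  (measurable_gaussianPDFReal_uncurry m).ennreal_ofReal

lemma IsContinuousBrownian.lintegral_measure_le_runMin [IsProbabilityMeasure P]
    (hB : IsContinuousBrownian B P)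
    {c : ℝ} (hc : c ≤ 0) {A : Set ℝ} (hA : MeasurableSet A) :
    ∫⁻ t in Set.Ioi (0:ℝ), P {ω | c ≤ runMin B t ω ∧ B t ω ∈ A}
      = ∫⁻ x in A ∩ Set.Ioi c, 2 * volume (Set.Ioo c (min 0 x)) := by
  rw [setLIntegral_congr_fun measurableSet_Ioi fun t ht => hB.measure_le_runMin ht hc hA,
    lintegral_lintegral_swap]
  · exact setLIntegral_congr_fun (hA.inter measurableSet_Ioi) fun x hx =>
      lintegral_Ioi_gaussianPDF_reflect hc hx.2
  · exact ((measurable_gaussianPDF_uncurry _).sub (measurable_gaussianPDF_uncurry _)).aemeasurable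

/-- The occupation measure of `(m_t, B_t)` on `(0, ∞)`. -/
lemma IsContinuousBrownian.map_runMin_prod [IsProbabilityMeasure P]
    (hB : IsContinuousBrownian B P) :
    ((volume.restrict (Set.Ioi (0:ℝ))).prod P).map (fun p => (runMin B p.1 p.2, B p.1 p.2))
      = (2 : ℝ≥0∞) • volume.restrict {p : ℝ × ℝ | p.1 < 0 ∧ p.1 < p.2} := by
  have hS : MeasurableSet {p : ℝ × ℝ | p.1 < 0 ∧ p.1 < p.2} :=
    (measurableSet_lt measurable_fst measurable_const).inter
      (measurableSet_lt measurable_fst measurable_snd)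
  have hmeas := hB.measurable_runMin_uncurry.prodMk hB.measurable_uncurry
  have key : ∀ (c : ℝ) (A : Set ℝ), MeasurableSet A →
      ((volume.restrict (Set.Ioi (0:ℝ))).prod P).map (fun p => (runMin B p.1 p.2, B p.1 p.2))
        (Set.Ici c ×ˢ A)
      = ((2 : ℝ≥0∞) • volume.restrict {p : ℝ × ℝ | p.1 < 0 ∧ p.1 < p.2}) (Set.Ici c ×ˢ A) := by
    intro c A hA
    have hR : MeasurableSet (Set.Ici c ×ˢ A) := measurableSet_Ici.prod hA
    rw [Measure.map_apply hmeas hR, Measure.prod_apply (hmeas hR), Measure.smul_apply,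
      Measure.restrict_apply hR, smul_eq_mul]
    rcases le_or_gt c 0 with hc | hc
    · refine (hB.lintegral_measure_le_runMin hc hA).trans ?_
      rw [Measure.volume_eq_prod, Measure.prod_apply_symm (hR.inter hS), lintegral_const_mul',
        ← lintegral_indicator (hA.inter measurableSet_Ioi)]
      · congr 1
        refine lintegral_congr fun x => ?_
        by_cases hx : x ∈ A ∩ Set.Ioi c
        · rw [Set.indicator_of_mem hx, Real.volume_Ioo, ← Real.volume_Ico]
          congr 1
          ext y
          simp [hx.1]
        · rw [Set.indicator_of_notMem hx, eq_comm]
          refine (congrArg _ (Set.eq_empty_of_forall_notMem ?_)).trans measure_empty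
          rintro y ⟨⟨h1, h2⟩, -, h3⟩
          exact hx ⟨h2, lt_of_le_of_lt h1 h3⟩
      · simp
    · have h1 : ∀ t, Prod.mk t ⁻¹' ((fun p : ℝ × Ω => (runMin B p.1 p.2, B p.1 p.2)) ⁻¹'
          (Set.Ici c ×ˢ A)) = ∅ := fun t => by
        refine Set.eq_empty_of_forall_notMem fun ω h => ?_
        have h : c ≤ runMin B t ω := h.1
        exact absurd (runMin_nonpos (hB.continuous ω) (hB.zero ω)) (not_le.2 (hc.trans_le h))
      have h2 : Set.Ici c ×ˢ A ∩ {p : ℝ × ℝ | p.1 < 0 ∧ p.1 < p.2} = ∅ := by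
        refine Set.eq_empty_of_forall_notMem fun p h => ?_
        have h1 : c ≤ p.1 := h.1.1
        exact absurd h.2.1 (not_lt.2 (hc.le.trans h1))
      simp [h1, h2]
  refine Measure.ext_of_generateFrom_of_iUnion
    (Set.image2 (· ×ˢ ·) (Set.range Set.Ici) {s : Set ℝ | MeasurableSet s})
    (fun n : ℕ => Set.Ici (-(n:ℝ)) ×ˢ Set.Icc (-(n:ℝ)) n) (generateFrom_eq_prod ?_
      MeasurableSpace.generateFrom_measurableSet ?_ isCountablySpanning_measurableSet).symm
    (isPiSystem_Ici.prod MeasurableSpace.isPiSystem_measurableSet) ?_ ?_ ?_ ?_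
  · rw [← borel_eq_generateFrom_Ici, BorelSpace.measurable_eq (α := ℝ)]
  · refine ⟨fun n : ℕ => Set.Ici (-(n:ℝ)), fun n => ⟨_, rfl⟩, ?_⟩
    refine Set.iUnion_eq_univ_iff.2 fun x => ?_
    obtain ⟨n, hn⟩ := exists_nat_ge (-x)
    exact ⟨n, by simp only [Set.mem_Ici]; linarith⟩
  · refine Set.iUnion_eq_univ_iff.2 fun p => ?_
    obtain ⟨n, hn⟩ := exists_nat_ge (max (-p.1) |p.2|)
    have h1 := (le_max_left _ _).trans hn
    have h2 := abs_le.1 ((le_max_right _ _).trans hn)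
    exact ⟨n, by simp only [Set.mem_Ici]; linarith, h2⟩
  · exact fun n => ⟨_, ⟨_, rfl⟩, _, Set.mem_ofPred.2 measurableSet_Icc, rfl⟩
  · intro n
    rw [key _ _ measurableSet_Icc, Measure.smul_apply,
      Measure.restrict_apply (measurableSet_Ici.prod measurableSet_Icc), smul_eq_mul]
    refine ENNReal.mul_ne_top (by simp) (measure_ne_top_of_subset
      (?_ : _ ⊆ Set.Icc (-(n:ℝ)) 0 ×ˢ Set.Icc (-(n:ℝ)) n)
      (isCompact_Icc.prod isCompact_Icc).measure_ne_top)
    exact fun p h => ⟨⟨h.1.1, h.2.1.le⟩, h.1.2⟩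
  · rintro _ ⟨_, ⟨c, rfl⟩, A, hA, rfl⟩
    exact key c A hA

lemma lintegral_wedge_sub (ε : ℝ) {g : ℝ → ℝ≥0∞} (hg : Measurable g) :
    ∫⁻ p in {p : ℝ × ℝ | p.1 < 0 ∧ p.1 < p.2},
        {p : ℝ × ℝ | -ε < p.1}.indicator (fun p => g (p.1 - p.2)) p
      = ENNReal.ofReal ε * ∫⁻ x in Set.Iio (0:ℝ), g x := by
  have hS : MeasurableSet {p : ℝ × ℝ | p.1 < 0 ∧ p.1 < p.2} :=
    (measurableSet_lt measurable_fst measurable_const).inter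
      (measurableSet_lt measurable_fst measurable_snd)
  have hT : MeasurableSet {p : ℝ × ℝ | -ε < p.1} := measurableSet_lt measurable_const measurable_fst
  have hH : Measurable ({p : ℝ × ℝ | -ε < p.1}.indicator fun p => g (p.1 - p.2)) :=
    (hg.comp (measurable_fst.sub measurable_snd)).indicator hT
  have hslice : ∀ y x : ℝ, {p : ℝ × ℝ | p.1 < 0 ∧ p.1 < p.2}.indicator
      ({p : ℝ × ℝ | -ε < p.1}.indicator fun p => g (p.1 - p.2)) (y, x)
      = (Set.Ioo (-ε) 0).indicator 1 y * (Set.Iio 0).indicator g (y - x) := by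
    intro y x
    simp only [Set.indicator, Set.mem_ofPred_eq, Set.mem_Ioo, Set.mem_Iio, sub_neg, Pi.one_apply]
    by_cases h1 : -ε < y <;> by_cases h2 : y < 0 <;> by_cases h3 : y < x <;> simp [h1, h2, h3]
  rw [← lintegral_indicator hS, Measure.volume_eq_prod,
    lintegral_prod _ (hH.indicator hS).aemeasurable]
  simp only [hslice]
  have hG : Measurable ((Set.Iio (0:ℝ)).indicator g) := hg.indicator measurableSet_Iio
  have hinner : ∀ y : ℝ, ∫⁻ x, (Set.Ioo (-ε) 0).indicator 1 y * (Set.Iio 0).indicator g (y - x)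
      = (Set.Ioo (-ε) 0).indicator 1 y * ∫⁻ x in Set.Iio (0:ℝ), g x := fun y => by
    rw [lintegral_const_mul _ (show Measurable fun x => (Set.Iio (0:ℝ)).indicator g (y - x) from
        hG.comp (measurable_id.const_sub y)),
      lintegral_sub_left_eq_self ((Set.Iio (0:ℝ)).indicator g) y,
      lintegral_indicator measurableSet_Iio]
  simp only [hinner]
  rw [lintegral_mul_const _ (measurable_one.indicator measurableSet_Ioo),
    lintegral_indicator_one measurableSet_Ioo, Real.volume_Ioo, sub_neg_eq_add, zero_add]

lemma IsContinuousBrownian.lintegral_occupation [IsProbabilityMeasure P]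
    (hB : IsContinuousBrownian B P) (ε : ℝ)
    {g : ℝ → ℝ≥0∞} (hg : Measurable g) :
    ∫⁻ ω, (∫⁻ t in Set.Ioi (0:ℝ), {t : ℝ | -ε < runMin B t ω}.indicator
        (fun t => g (runMin B t ω - B t ω)) t) ∂P
      = 2 * (ENNReal.ofReal ε * ∫⁻ x in Set.Iio (0:ℝ), g x) := by
  have hmeas := hB.measurable_runMin_uncurry.prodMk hB.measurable_uncurry
  have hH : Measurable ({p : ℝ × ℝ | -ε < p.1}.indicator fun p => g (p.1 - p.2)) :=
    (hg.comp (measurable_fst.sub measurable_snd)).indicator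
      (measurableSet_lt measurable_const measurable_fst)
  rw [← lintegral_wedge_sub ε hg, ← smul_eq_mul, ← lintegral_smul_measure, ← hB.map_runMin_prod,
    lintegral_map hH hmeas]
  exact (lintegral_prod_symm' _ (hH.comp hmeas)).symm

/-- A Brownian motion has a version all of whose paths are continuous and start from `0`. -/
lemma exists_isContinuousBrownian (hmeas : ∀ t : ℝ, Measurable (B t))
    (hcont : ∀ᵐ ω ∂P, ContinuousOn (fun t => B t ω) (Set.Ici (0:ℝ)))
    (h0 : ∀ᵐ ω ∂P, B 0 ω = 0)
    (hgauss : ∀ s t : ℝ, 0 ≤ s → s ≤ t →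
      P.map (fun ω => B t ω - B s ω) = gaussianReal 0 (Real.toNNReal (t - s)))
    (hindep : ∀ s t : ℝ, 0 ≤ s → s ≤ t → ∀ (n : ℕ) (r : Fin n → ℝ),
      (∀ i, 0 ≤ r i ∧ r i ≤ s) →
      IndepFun (fun ω => B t ω - B s ω) (fun ω i => B (r i) ω) P) :
    ∃ B' : ℝ → Ω → ℝ, IsContinuousBrownian B' P ∧
      ∀ᵐ ω ∂P, ∀ t, 0 ≤ t → B' t ω = B t ω := by
  obtain ⟨G, hG, hGm, hGsub⟩ := (hcont.and h0).exists_measurable_mem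
  set B' : ℝ → Ω → ℝ := fun t => G.indicator (B (max t 0)) with hB'
  have heq : ∀ᵐ ω ∂P, ∀ t, 0 ≤ t → B' t ω = B t ω := by
    filter_upwards [hG] with ω hω t ht
    rw [hB']
    simp only [Set.indicator_of_mem hω, max_eq_left ht]
  refine ⟨B', ⟨fun t => (hmeas _).indicator hGm, fun ω => ?_, fun ω => ?_, fun s t hs hst => ?_,
    fun s t hs hst n r hr => ?_⟩, heq⟩
  · by_cases hω : ω ∈ G
    · simp only [hB', Set.indicator_of_mem hω]
      exact (hGsub ω hω).1.comp_continuous (continuous_id.max continuous_const)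
        fun t => Set.mem_Ici.2 (le_max_right _ _)
    · simp only [hB', Set.indicator_of_notMem hω]
      exact continuous_const
  · by_cases hω : ω ∈ G
    · simp only [hB', Set.indicator_of_mem hω, max_self]
      exact (hGsub ω hω).2
    · simp only [hB', Set.indicator_of_notMem hω]
  · rw [← hgauss s t hs hst]
    refine Measure.map_congr ?_
    filter_upwards [heq] with ω hω
    rw [hω s hs, hω t (hs.trans hst)]
  · refine (hindep s t hs hst n r hr).congr ?_ ?_
    · filter_upwards [heq] with ω hω
      rw [hω s hs, hω t (hs.trans hst)]
    · filter_upwards [heq] with ω hω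
      ext i
      rw [hω (r i) (hr i).1]

end Occupation

/-- Let `B` be a standard linear Brownian motion started from `0` and
`m_t = min_{0 ≤ r ≤ t} B_r` its running minimum. For every `ε > 0` and every
nonnegative measurable `g`,
`E[∫₀^∞ 1{m_t > -ε} g(m_t - B_t) dt] = 2ε ∫_{-∞}^0 g(x) dx`. -/
theorem brownian_min_occupation {Ω : Type*} [MeasureSpace Ω]
    [IsProbabilityMeasure (ℙ : Measure Ω)]
    (B : ℝ → Ω → ℝ)
    -- measurability of each `B_t`
    (hmeas : ∀ t : ℝ, Measurable (B t))
    -- almost surely continuous sample paths on `[0,∞)`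
    (hcont : ∀ᵐ ω ∂(ℙ : Measure Ω), ContinuousOn (fun t => B t ω) (Set.Ici (0:ℝ)))
    -- starts from `0`
    (h0 : ∀ᵐ ω ∂(ℙ : Measure Ω), B 0 ω = 0)
    -- for `0 ≤ s ≤ t`, the increment `B_t - B_s` is centered Gaussian with variance `t - s`
    (hgauss : ∀ s t : ℝ, 0 ≤ s → s ≤ t →
      Measure.map (fun ω => B t ω - B s ω) ℙ = gaussianReal 0 (Real.toNNReal (t - s)))
    -- for `0 ≤ s ≤ t`, the increment `B_t - B_s` is independent of `(B_r)_{0 ≤ r ≤ s}`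
    (hindep : ∀ s t : ℝ, 0 ≤ s → s ≤ t → ∀ (n : ℕ) (r : Fin n → ℝ),
      (∀ i, 0 ≤ r i ∧ r i ≤ s) →
      IndepFun (fun ω => B t ω - B s ω) (fun ω i => B (r i) ω) ℙ)
    (ε : ℝ) (hε : 0 < ε) (g : ℝ → ℝ≥0∞) (hg : Measurable g) :
    (∫⁻ ω, (∫⁻ t in Set.Ioi (0:ℝ),
        Set.indicator {t : ℝ | -ε < sInf ((fun r => B r ω) '' Set.Icc 0 t)}
          (fun t => g (sInf ((fun r => B r ω) '' Set.Icc 0 t) - B t ω)) t) ∂(ℙ : Measure Ω))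
      = ENNReal.ofReal (2 * ε) * ∫⁻ x in Set.Iio (0:ℝ), g x := by
  obtain ⟨B', hB', heq⟩ := exists_isContinuousBrownian hmeas hcont h0 hgauss hindep
  rw [ENNReal.ofReal_mul zero_le_two, ENNReal.ofReal_ofNat, mul_assoc,
    ← hB'.lintegral_occupation ε hg]
  refine lintegral_congr_ae ?_
  filter_upwards [heq] with ω hω
  refine setLIntegral_congr_fun measurableSet_Ioi fun t ht => ?_
  have hmin : ∀ t, 0 < t → sInf ((fun r => B r ω) '' Set.Icc 0 t) = runMin B' t ω := fun t ht => by
    rw [runMin_eq_sInf ht.le]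
    congr 1
    exact Set.image_congr fun r hr => (hω r hr.1).symm
  simp only [Set.indicator, Set.mem_ofPred_eq, hmin t ht, hω t (le_of_lt ht)]
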